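/- arXiv:1806.05286 — 2 statements merged into one kernel-verified Lean document; each statement's English description precedes it below -/
import Mathlib

section
/- Let G be a connected simple graph, let v be a vertex of G, let m be a natural number, and let T be a finite set of vertices of G each of which is equal to v or adjacent to v (i.e., T is contained in the closed neighborhood of v), with |T| > 3^m. Then for any vertices u_1, …, u_m of G there exist two distinct vertices w, x ∈ T such that d_G(u_i, w) = d_G(u_i, x) for every i ∈ {1, …, m}. -/
/-- The distances from `a` to two vertices at distance at most one differ by at most one. -/
theorem SimpleGraph.Connected.dist_mem_Icc_of_dist_le_one {V : Type*} {G : SimpleGraph V}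
    (hG : G.Connected) {v w : V} (h : G.dist v w ≤ 1) (a : V) :
    G.dist a w ∈ Finset.Icc (G.dist a v - 1) (G.dist a v + 1) := by
  have h₁ : G.dist a w ≤ G.dist a v + G.dist v w := hG.dist_triangle
  have h₂ : G.dist a v ≤ G.dist a w + G.dist w v := hG.dist_triangle
  rw [G.dist_comm (u := w)] at h₂
  rw [Finset.mem_Icc]
  omega

/-- Pigeonhole step: if `T` lies in the closed neighborhood of `v` and `|T| > 3^m`,
then any `m` probes `u i` fail to distinguish some two distinct vertices of `T`. -/
theorem stmt_0 {V : Type*} [DecidableEq V] (G : SimpleGraph V) (hG : G.Connected)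
    (v : V) (m : ℕ) (T : Finset V)
    (hT : ∀ w ∈ T, w = v ∨ G.Adj v w)
    (hcard : 3 ^ m < T.card) (u : Fin m → V) :
    ∃ w ∈ T, ∃ x ∈ T, w ≠ x ∧ ∀ i : Fin m, G.dist (u i) w = G.dist (u i) x := by
  let S : Finset (Fin m → ℕ) :=
    Fintype.piFinset fun i ↦ Finset.Icc (G.dist (u i) v - 1) (G.dist (u i) v + 1)
  have hS : S.card ≤ 3 ^ m := by
    rw [Fintype.card_piFinset]
    refine (Finset.prod_le_pow_card _ _ 3 fun i _ ↦ ?_).trans_eq (by simp)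
    rw [Nat.card_Icc]
    omega
  have hmaps : ∀ w ∈ T, (fun i ↦ G.dist (u i) w) ∈ S := by
    intro w hw
    refine Fintype.mem_piFinset.mpr fun i ↦ hG.dist_mem_Icc_of_dist_le_one ?_ (u i)
    rcases hT w hw with rfl | hadj
    · simp
    · exact (SimpleGraph.dist_eq_one_iff_adj.mpr hadj).le
  obtain ⟨w, hw, x, hx, hne, heq⟩ :=
    Finset.exists_ne_map_eq_of_card_lt_of_maps_to (hS.trans_lt hcard) hmaps
  exact ⟨w, hw, x, hx, hne, congrFun heq⟩
end

section
/- Let G be a connected bipartite simple graph (i.e., G admits a proper 2-coloring), let v be a vertex of G, let m be a natural number, and let T be a finite set of vertices of G each of which is adjacent to v (i.e., T is contained in the open neighborhood of v), with |T| > 2^m. Then for any vertices u_1, …, u_m of G there exist two distinct vertices w, x ∈ T such that d_G(u_i, w) = d_G(u_i, x) for every i ∈ {1, …, m}. -/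
/-- In a bipartite graph, adjacent vertices are at different distances from any vertex from which
they are reachable. -/
theorem SimpleGraph.Adj.dist_ne_of_colorable_two {V : Type*} {G : SimpleGraph V} {u v w : V}
    (hvw : G.Adj v w) (hbip : G.Colorable 2) (huv : G.Reachable u v) :
    G.dist u v ≠ G.dist u w := by
  intro h
  obtain ⟨p, hp⟩ := huv.exists_walk_length_eq_dist
  obtain ⟨q, hq⟩ := (huv.trans hvw.reachable).exists_walk_length_eq_dist
  let c : G.Coloring Bool := hbip.toColoring (by simp)
  have hpc := c.even_length_iff_congr p
  have hqc := c.even_length_iff_congr q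
  have hne := c.valid hvw
  rw [hp, h] at hpc
  rw [hq] at hqc
  apply hne
  rw [Bool.eq_iff_iff]
  tauto

/-- Bipartite pigeonhole step: if `T` lies in the open neighborhood of `v` and `|T| > 2^m`,
then any `m` probes `u i` fail to distinguish some two distinct vertices of `T`. -/
theorem stmt_1 {V : Type*} [DecidableEq V] (G : SimpleGraph V) (hG : G.Connected)
    (hbip : G.Colorable 2) (v : V) (m : ℕ) (T : Finset V)
    (hT : ∀ w ∈ T, G.Adj v w)
    (hcard : 2 ^ m < T.card) (u : Fin m → V) :
    ∃ w ∈ T, ∃ x ∈ T, w ≠ x ∧ ∀ i : Fin m, G.dist (u i) w = G.dist (u i) x := by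
  let f : V → Fin m → Bool := fun w i ↦ decide (G.dist (u i) v < G.dist (u i) w)
  obtain ⟨w, hw, x, hx, hne, hf⟩ := Finset.exists_ne_map_eq_of_card_lt_of_maps_to
    (s := T) (t := Finset.univ) (f := f) (by simpa using hcard) (by simp [Set.MapsTo])
  refine ⟨w, hw, x, hx, hne, fun i ↦ ?_⟩
  have hfi : G.dist (u i) v < G.dist (u i) w ↔ G.dist (u i) v < G.dist (u i) x := by
    simpa [f] using congrFun hf i
  have hw_ne := (hT w hw).dist_ne_of_colorable_two hbip (hG.preconnected (u i) v)
  have hx_ne := (hT x hx).dist_ne_of_colorable_two hbip (hG.preconnected (u i) v)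
  have hw_diff := (hT w hw).diff_dist_adj (u := u i)
  have hx_diff := (hT x hx).diff_dist_adj (u := u i)
  omega
end
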